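/- The complex-valued improper integral ∫_0^∞ x^{3/2} log(-x) log(log(-x)) / (1+x^5) dx, where for real x > 0 the quantity log(-x) denotes the principal complex logarithm of the negative real number -x (so log(-x) = log x + iπ) and the outer logarithm is also the principal complex logarithm, equals -(π²/25) ( 5π/2 + i·log( 3125 A^{12} / (16384 · 2^{1/3} · e · π^5) ) ), where A = exp(1/12 - ζ'(-1)) is Glaisher's constant and ζ' is the derivative of the Riemann zeta function. -/

import Mathlib

open Complex MeasureTheory

/-- Glaisher's constant `A = exp(1/12 - ζ'(-1))`. -/
noncomputable def glaisher : ℂ := Complex.exp (1 / 12 - deriv riemannZeta (-1))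

noncomputable def wt (t : ℝ) : ℝ := 1 / (2 * Real.cosh (5 * t / 2))

lemma wt_cont : Continuous wt := by
  unfold wt
  refine continuous_const.div (by fun_prop) (fun t => ?_)
  have := Real.cosh_pos (5 * t / 2)
  positivity

lemma wt_pos (t : ℝ) : 0 < wt t := by
  unfold wt
  have := Real.cosh_pos (5 * t / 2)
  positivity

lemma wt_le (t : ℝ) : wt t ≤ Real.exp (-(5 / 2) * |t|) := by
  unfold wt
  have h : Real.exp (5 / 2 * |t|) ≤ 2 * Real.cosh (5 * t / 2) := by
    rw [← Real.cosh_abs, Real.cosh_eq]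
    have : |5 * t / 2| = 5 / 2 * |t| := by
      rw [abs_div, abs_mul]; norm_num; ring
    rw [this]
    have := Real.exp_pos (-(5 / 2 * |t|))
    linarith
  rw [neg_mul, Real.exp_neg, ← one_div]
  exact one_div_le_one_div_of_le (Real.exp_pos _) h

lemma integrable_exp_abs {c : ℝ} (hc : 0 < c) :
    Integrable (fun t : ℝ => Real.exp (-c * |t|)) := by
  rw [← integrableOn_univ, ← Set.Iic_union_Ioi (a := (0:ℝ)), integrableOn_union]
  constructor
  · refine (integrableOn_exp_mul_Iic hc 0).congr_fun (fun t ht => ?_) measurableSet_Iic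
    simp only
    rw [abs_of_nonpos ht]; ring_nf
  · refine (integrableOn_exp_mul_Ioi (neg_lt_zero.mpr hc) 0).congr_fun (fun t ht => ?_)
      measurableSet_Ioi
    simp only
    rw [abs_of_pos ht]

lemma wt_integrable : Integrable wt := by
  refine (integrable_exp_abs (c := 5 / 2) (by norm_num)).mono' wt_cont.aestronglyMeasurable ?_
  filter_upwards with t
  rw [Real.norm_of_nonneg (wt_pos t).le]
  exact wt_le t

lemma sig_eq (t : ℝ) : Real.sigmoid (5 * t) = Real.exp (5 * t / 2) * wt t := by
  unfold wt
  rw [Real.sigmoid_def, Real.cosh_eq]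
  have h1 : Real.exp (-(5 * t)) = Real.exp (-(5 * t / 2)) * Real.exp (-(5 * t / 2)) := by
    rw [← Real.exp_add]; ring_nf
  have h2 : Real.exp (5 * t / 2) = (Real.exp (-(5 * t / 2)))⁻¹ := by
    rw [← Real.exp_neg]; ring_nf
  have := Real.exp_pos (-(5 * t / 2))
  rw [h1, h2]
  field_simp

lemma one_sub_sig_eq (t : ℝ) : 1 - Real.sigmoid (5 * t) = Real.exp (-(5 * t / 2)) * wt t := by
  rw [← Real.sigmoid_neg]
  have := sig_eq (-t)
  have e : wt (-t) = wt t := by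
    unfold wt; rw [← Real.cosh_neg]; ring_nf
  rw [e] at this
  convert this using 2 <;> ring_nf

lemma fourier_wt (u : ℝ) :
    ∫ t : ℝ, cexp (u * t * I) * (wt t : ℂ) = (Real.pi / 5 : ℂ) / Complex.cosh (Real.pi * u / 5) := by
  set p : ℂ := 1 / 2 + u / 5 * I with hp
  have hpre : p.re = 1 / 2 := by simp [hp]
  have hq : (1 - p).re = 1 / 2 := by simp [hpre]; norm_num
  have hB := Complex.Gamma_mul_Gamma_eq_betaIntegral (s := p) (t := 1 - p) (by rw [hpre]; norm_num)
    (by rw [hq]; norm_num)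
  rw [Complex.Gamma_mul_Gamma_one_sub, add_sub_cancel, Complex.Gamma_one, one_mul] at hB
  have hsin : Complex.sin (Real.pi * p) = Complex.cosh (Real.pi * u / 5) := by
    rw [hp, ← Complex.cos_mul_I, ← Complex.sin_add_pi_div_two]
    congr 1; ring
  rw [hsin] at hB
  have key : betaIntegral p (1 - p) = ∫ t : ℝ, 5 * (cexp (u * t * I) * (wt t : ℂ)) := by
    rw [betaIntegral, intervalIntegral.integral_of_le zero_le_one, integral_Ioc_eq_integral_Ioo]
    have himg : (fun t : ℝ => Real.sigmoid (5 * t)) '' Set.univ = Set.Ioo 0 1 := by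
      rw [Set.image_univ, ← Real.range_sigmoid]
      ext y; constructor
      · rintro ⟨t, rfl⟩; exact ⟨_, rfl⟩
      · rintro ⟨t, rfl⟩; exact ⟨t / 5, by simp only; congr 1; ring⟩
    rw [← himg, integral_image_eq_integral_abs_deriv_smul
      (f' := fun t => 5 * (Real.sigmoid (5 * t) * (1 - Real.sigmoid (5 * t)))) MeasurableSet.univ]
    · rw [Measure.restrict_univ]
      refine integral_congr_ae (Filter.Eventually.of_forall fun t => ?_)
      simp only
      have h1 := Real.sigmoid_pos (5 * t)
      have h2 : 0 < 1 - Real.sigmoid (5 * t) := sub_pos.mpr (Real.sigmoid_lt_one _)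
      rw [abs_of_pos (by positivity), real_smul, ← ofReal_one, ← ofReal_sub]
      have hw := wt_pos t
      have hx : ((Real.sigmoid (5 * t) : ℝ) : ℂ) ^ (p - ((1:ℝ):ℂ))
          = cexp ((5 * t / 2 + Real.log (wt t)) * (p - 1)) := by
        rw [sig_eq, cpow_def_of_ne_zero (by exact_mod_cast (by positivity)), ← ofReal_log (by positivity),
          Real.log_mul (by positivity) hw.ne', Real.log_exp]
        push_cast; rfl
      have hy : ((1 - Real.sigmoid (5 * t) : ℝ) : ℂ) ^ (((1:ℝ):ℂ) - p - ((1:ℝ):ℂ))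
          = cexp ((-(5 * t / 2) + Real.log (wt t)) * (-p)) := by
        rw [one_sub_sig_eq, cpow_def_of_ne_zero (by exact_mod_cast (by positivity)), ← ofReal_log (by positivity),
          Real.log_mul (by positivity) hw.ne', Real.log_exp]
        push_cast; ring_nf
      rw [hx, hy, one_sub_sig_eq, sig_eq]
      have hwl : (wt t : ℂ) = cexp (Real.log (wt t)) := by
        rw [← ofReal_exp, Real.exp_log hw]
      push_cast
      rw [hwl]
      simp only [mul_assoc, ← Complex.exp_add]
      congr 2
      rw [hp]; ring
    · intro t _
      have := ((Real.hasDerivAt_sigmoid (5 * t)).comp t ((hasDerivAt_id t).const_mul 5))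
      refine HasDerivAt.hasDerivWithinAt ?_
      convert! this using 1
      simp; ring
    · intro a _ b _ h
      have := Real.sigmoid_injective h
      linarith
  rw [key, integral_const_mul] at hB
  have : (∫ t : ℝ, cexp (u * t * I) * (wt t : ℂ)) = (Real.pi / Complex.cosh (Real.pi * u / 5)) / 5 := by
    rw [hB]; ring
  rw [this]; ring

lemma integrable_gamma_kernel {a c : ℝ} (ha : 0 < a) (hc : 0 < c) :
    IntegrableOn (fun u : ℝ => u ^ (a - 1) * Real.exp (-(c * u))) (Set.Ioi 0) := by
  refine .of_integral_ne_zero ?_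
  rw [Real.integral_rpow_mul_exp_neg_mul_Ioi ha hc]
  have := Real.Gamma_pos_of_pos ha
  positivity

lemma gamma_meas (a r : ℂ) : AEStronglyMeasurable
    (fun u : ℝ => (u : ℂ) ^ a * cexp (-(r * u))) (volume.restrict (Set.Ioi 0)) := by
  refine ContinuousOn.aestronglyMeasurable ?_ measurableSet_Ioi
  refine ContinuousOn.mul ?_ (by fun_prop)
  intro u hu
  refine ContinuousAt.continuousWithinAt ?_
  exact (continuousAt_ofReal_cpow_const u a (Or.inr (ne_of_gt hu)))

lemma gamma_norm (a r : ℂ) {u : ℝ} (hu : 0 < u) :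
    ‖(u : ℂ) ^ a * cexp (-(r * u))‖ = u ^ a.re * Real.exp (-(r.re * u)) := by
  rw [norm_mul, norm_cpow_eq_rpow_re_of_pos hu, norm_exp]
  simp

lemma gamma_integrable {a r : ℂ} (ha : 0 < a.re) (hr : 0 < r.re) :
    IntegrableOn (fun u : ℝ => (u : ℂ) ^ (a - 1) * cexp (-(r * u))) (Set.Ioi 0) := by
  refine (integrable_gamma_kernel ha hr).mono' (gamma_meas _ _) ?_
  filter_upwards [ae_restrict_mem measurableSet_Ioi] with u hu
  rw [gamma_norm _ _ hu]; simp

lemma gamma_diff {a r : ℂ} (ha : 0 < a.re) (hr : 0 < r.re) :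
    DifferentiableAt ℂ (fun r : ℂ => ∫ u : ℝ in Set.Ioi 0, (u : ℂ) ^ (a - 1) * cexp (-(r * u))) r := by
  have h := hasDerivAt_integral_of_dominated_loc_of_deriv_le
    (μ := volume.restrict (Set.Ioi (0:ℝ))) (𝕜 := ℂ) (E := ℂ) (x₀ := r)
    (s := {z : ℂ | r.re / 2 < z.re})
    (F := fun r u => (u : ℂ) ^ (a - 1) * cexp (-(r * u)))
    (F' := fun r u => (u : ℂ) ^ (a - 1) * (cexp (-(r * u)) * (-u)))
    (bound := fun u => u ^ (a.re + 1 - 1) * Real.exp (-(r.re / 2 * u)))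
    ((isOpen_lt continuous_const continuous_re).mem_nhds (by simp; linarith))
    (Filter.Eventually.of_forall fun z => gamma_meas _ _) (gamma_integrable ha hr)
    ?_ ?_ (integrable_gamma_kernel (by linarith) (by linarith)) ?_
  · exact h.2.differentiableAt
  · simp only [← mul_assoc]
    exact (gamma_meas _ _).mul (by fun_prop)
  · filter_upwards [ae_restrict_mem measurableSet_Ioi] with u hu z hz
    have hu' : (0:ℝ) < u := hu
    rw [← mul_assoc, norm_mul, gamma_norm _ _ hu, norm_neg, norm_real, Real.norm_of_nonneg hu'.le]
    have e : u ^ (a.re + 1 - 1) = u ^ (a - 1).re * u := by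
      rw [← Real.rpow_add_one hu'.ne']; simp
    rw [e]
    have : Real.exp (-(z.re * u)) ≤ Real.exp (-(r.re / 2 * u)) := by
      apply Real.exp_le_exp.mpr
      have : r.re / 2 * u ≤ z.re * u := mul_le_mul_of_nonneg_right (le_of_lt hz) hu'.le
      linarith
    have h0 : 0 ≤ u ^ (a - 1).re := Real.rpow_nonneg hu'.le _
    calc _ = u ^ (a - 1).re * u * Real.exp (-(z.re * u)) := by ring
      _ ≤ _ := by gcongr
  · filter_upwards with u z _
    refine HasDerivAt.const_mul _ ?_
    refine HasDerivAt.cexp ?_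
    simpa using! ((hasDerivAt_id z).mul_const (u : ℂ)).fun_neg

lemma gamma_complex {a r : ℂ} (ha : 0 < a.re) (hr : 0 < r.re) :
    ∫ u : ℝ in Set.Ioi 0, (u : ℂ) ^ (a - 1) * cexp (-(r * u)) = r ^ (-a) * Gamma a := by
  have hopen : IsOpen {z : ℂ | 0 < z.re} := isOpen_lt continuous_const continuous_re
  have hconv : IsPreconnected {z : ℂ | 0 < z.re} := (convex_halfSpace_re_gt 0).isPreconnected
  have hf : AnalyticOnNhd ℂ (fun r : ℂ => ∫ u : ℝ in Set.Ioi 0, (u : ℂ) ^ (a - 1) * cexp (-(r * u)))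
      {z : ℂ | 0 < z.re} :=
    DifferentiableOn.analyticOnNhd (fun z hz => (gamma_diff ha hz).differentiableWithinAt) hopen
  have hg : AnalyticOnNhd ℂ (fun r : ℂ => r ^ (-a) * Gamma a) {z : ℂ | 0 < z.re} :=
    DifferentiableOn.analyticOnNhd (fun z hz =>
      (((differentiableAt_id.cpow_const (Or.inl hz)).mul_const _)).differentiableWithinAt) hopen
  refine hf.eqOn_of_preconnected_of_frequently_eq hg hconv (z₀ := 1) (by simp) ?_ hr
  have hreal : ∀ x : ℝ, 0 < x → (∫ u : ℝ in Set.Ioi 0, (u : ℂ) ^ (a - 1) * cexp (-((x:ℂ) * u)))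
      = (x : ℂ) ^ (-a) * Gamma a := by
    intro x hx
    rw [Complex.integral_cpow_mul_exp_neg_mul_Ioi ha hx, one_div, cpow_neg,
      inv_cpow _ _ (by rw [arg_ofReal_of_nonneg hx.le]; exact Real.pi_pos.ne)]
  have ht : Filter.Tendsto (fun n : ℕ => ((1 + 1 / ((n:ℝ) + 1) : ℝ) : ℂ)) Filter.atTop (nhdsWithin 1 {1}ᶜ) := by
    rw [tendsto_nhdsWithin_iff]
    constructor
    · have : Filter.Tendsto (fun n : ℕ => (1 + 1 / ((n:ℝ) + 1) : ℝ)) Filter.atTop (nhds (1 + 0)) :=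
        tendsto_const_nhds.add tendsto_one_div_add_atTop_nhds_zero_nat
      have h2 := (continuous_ofReal.tendsto _).comp this
      rw [add_zero, ofReal_one] at h2
      exact h2
    · refine Filter.Eventually.of_forall fun n => ?_
      have : (0:ℝ) < 1 / ((n:ℝ) + 1) := by positivity
      simp only [Set.mem_compl_iff, Set.mem_singleton_iff]
      intro h
      have h' : (1 + 1 / ((n:ℝ) + 1) : ℝ) = 1 := by exact_mod_cast h
      linarith
  refine ht.frequently (Filter.Frequently.of_forall fun n => ?_)
  exact hreal _ (by positivity)

noncomputable def zt (t : ℝ) : ℂ := (Real.pi : ℂ) - t * I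

lemma zt_re (t : ℝ) : (zt t).re = Real.pi := by simp [zt]

lemma zt_cont : Continuous zt := by unfold zt; fun_prop

lemma zt_slit (t : ℝ) : zt t ∈ slitPlane := Or.inl (by rw [zt_re]; exact Real.pi_pos)

lemma zt_ne (t : ℝ) : zt t ≠ 0 := slitPlane_ne_zero (zt_slit t)

lemma zt_norm_ge (t : ℝ) : Real.pi ≤ ‖zt t‖ := by
  have := abs_re_le_norm (zt t)
  rw [zt_re, abs_of_pos Real.pi_pos] at this
  exact this

lemma zt_norm_le (t : ℝ) : ‖zt t‖ ≤ Real.pi + |t| := by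
  unfold zt
  refine (norm_sub_le _ _).trans ?_
  simp [abs_of_pos Real.pi_pos]

lemma zt_cpow_norm (N : ℕ) (t : ℝ) (s : ℂ) (hs : ‖s‖ ≤ N) :
    ‖zt t ^ s‖ ≤ ‖zt t‖ ^ N * Real.exp (Real.pi * N) := by
  rw [norm_cpow_of_ne_zero (zt_ne t), div_eq_mul_inv, ← Real.exp_neg]
  have h1 : 1 ≤ ‖zt t‖ := by linarith [zt_norm_ge t, Real.pi_gt_three]
  have hre : s.re ≤ N := ((le_abs_self _).trans (abs_re_le_norm s)).trans hs
  have him : |s.im| ≤ N := (abs_im_le_norm s).trans hs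
  gcongr
  · rw [← Real.rpow_natCast]
    exact Real.rpow_le_rpow_of_exponent_le h1 hre
  · refine (le_abs_self _).trans ?_
    rw [abs_neg, abs_mul]
    gcongr
    exact abs_arg_le_pi _

lemma zt_log_norm (t : ℝ) : ‖Complex.log (zt t)‖ ≤ 2 * ‖zt t‖ := by
  have h1 : 1 ≤ ‖zt t‖ := by linarith [zt_norm_ge t, Real.pi_gt_three]
  refine (norm_le_abs_re_add_abs_im _).trans ?_
  rw [log_re, log_im, abs_of_nonneg (Real.log_nonneg h1)]
  have := Real.log_le_sub_one_of_pos (lt_of_lt_of_le one_pos h1)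
  have := abs_arg_le_pi (zt t)
  have := zt_norm_ge t
  linarith

lemma bound_aux (N : ℕ) (t : ℝ) : ‖zt t‖ ^ N * wt t ≤
    N.factorial * Real.exp Real.pi * Real.exp (-(3 / 2) * |t|) := by
  have h := Real.pow_div_factorial_le_exp (x := Real.pi + |t|) (by positivity) N
  rw [div_le_iff₀ (by positivity)] at h
  have h2 : ‖zt t‖ ^ N ≤ (Real.pi + |t|) ^ N := by
    gcongr
    exact zt_norm_le t
  calc _ ≤ (Real.exp (Real.pi + |t|) * N.factorial) * Real.exp (-(5 / 2) * |t|) :=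
        mul_le_mul (h2.trans h) (wt_le t) (wt_pos t).le (by positivity)
    _ = N.factorial * (Real.exp (Real.pi + |t|) * Real.exp (-(5 / 2) * |t|)) := by ring
    _ = _ := by
      rw [mul_assoc, ← Real.exp_add, ← Real.exp_add]; ring_nf

noncomputable def Fs (s : ℂ) : ℂ := ∫ t : ℝ, zt t ^ s * (wt t : ℂ)

lemma F_cont (s : ℂ) : Continuous (fun t => zt t ^ s * (wt t : ℂ)) :=
  (zt_cont.cpow continuous_const zt_slit).mul (continuous_ofReal.comp wt_cont)

lemma dF_cont (s : ℂ) : Continuous (fun t => zt t ^ s * Complex.log (zt t) * (wt t : ℂ)) :=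
  ((zt_cont.cpow continuous_const zt_slit).mul (zt_cont.clog zt_slit)).mul
    (continuous_ofReal.comp wt_cont)

lemma F_integrable (s : ℂ) : Integrable (fun t => zt t ^ s * (wt t : ℂ)) := by
  obtain ⟨N, hN⟩ := exists_nat_ge ‖s‖
  refine ((integrable_exp_abs (c := 3 / 2) (by norm_num)).const_mul
    (Real.exp (Real.pi * N) * (N.factorial * Real.exp Real.pi))).mono' (F_cont s).aestronglyMeasurable ?_
  filter_upwards with t
  rw [norm_mul, norm_real, Real.norm_of_nonneg (wt_pos t).le]
  have hw := wt_pos t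
  calc _ ≤ ‖zt t‖ ^ N * Real.exp (Real.pi * N) * wt t := by
        gcongr; exact zt_cpow_norm N t s hN
    _ = Real.exp (Real.pi * N) * (‖zt t‖ ^ N * wt t) := by ring
    _ ≤ Real.exp (Real.pi * N) * (N.factorial * Real.exp Real.pi * Real.exp (-(3 / 2) * |t|)) := by
        exact mul_le_mul_of_nonneg_left (bound_aux N t) (by positivity)
    _ = _ := by ring

lemma F_hasDeriv (s : ℂ) :
    Integrable (fun t => zt t ^ s * Complex.log (zt t) * (wt t : ℂ)) ∧
    HasDerivAt Fs (∫ t : ℝ, zt t ^ s * Complex.log (zt t) * (wt t : ℂ)) s := by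
  obtain ⟨N, hN⟩ := exists_nat_ge (‖s‖ + 1)
  refine hasDerivAt_integral_of_dominated_loc_of_deriv_le (𝕜 := ℂ) (s := Metric.ball s 1)
    (F := fun s t => zt t ^ s * (wt t : ℂ))
    (F' := fun s t => zt t ^ s * Complex.log (zt t) * (wt t : ℂ))
    (bound := fun t => 2 * Real.exp (Real.pi * N) * ((N + 1).factorial * Real.exp Real.pi) *
      Real.exp (-(3 / 2) * |t|))
    (Metric.ball_mem_nhds s one_pos)
    (Filter.Eventually.of_forall fun s => (F_cont s).aestronglyMeasurable) (F_integrable s)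
    (dF_cont s).aestronglyMeasurable ?_ ((integrable_exp_abs (by norm_num)).const_mul _) ?_
  · filter_upwards with t x hx
    have hxN : ‖x‖ ≤ N := by
      rw [mem_ball_iff_norm] at hx
      have := norm_le_norm_add_norm_sub' x s
      linarith
    rw [norm_mul, norm_mul, norm_real, Real.norm_of_nonneg (wt_pos t).le]
    have hw := wt_pos t
    calc _ ≤ (‖zt t‖ ^ N * Real.exp (Real.pi * N)) * (2 * ‖zt t‖) * wt t := by
          gcongr
          · exact zt_cpow_norm N t x hxN
          · exact zt_log_norm t
      _ = 2 * Real.exp (Real.pi * N) * (‖zt t‖ ^ (N + 1) * wt t) := by ring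
      _ ≤ 2 * Real.exp (Real.pi * N) * ((N + 1).factorial * Real.exp Real.pi * Real.exp (-(3 / 2) * |t|)) := by
          exact mul_le_mul_of_nonneg_left (bound_aux (N + 1) t) (by positivity)
      _ = _ := by ring
  · filter_upwards with t x _
    refine HasDerivAt.mul_const ?_ _
    exact (hasStrictDerivAt_const_cpow (Or.inl (zt_ne t))).hasDerivAt

lemma F_fubini {σ : ℂ} (hσ : 0 < σ.re) :
    Gamma σ * Fs (-σ) =
      mellin (fun u : ℝ => cexp (-(Real.pi * u)) * ((Real.pi / 5 : ℂ) / Complex.cosh (Real.pi * u / 5))) σ := by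
  have h1 : Gamma σ * Fs (-σ) = ∫ t : ℝ, ∫ u : ℝ in Set.Ioi 0,
      (u : ℂ) ^ (σ - 1) * cexp (-(zt t * u)) * (wt t : ℂ) := by
    rw [Fs, ← integral_const_mul]
    refine integral_congr_ae (Filter.Eventually.of_forall fun t => ?_)
    simp only
    rw [integral_mul_const, gamma_complex hσ (by rw [zt_re]; exact Real.pi_pos)]
    ring
  rw [h1, integral_integral_swap, mellin]
  · refine setIntegral_congr_fun measurableSet_Ioi fun u hu => ?_
    simp only [smul_eq_mul]
    rw [← fourier_wt, ← mul_assoc, ← integral_const_mul]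
    refine integral_congr_ae (Filter.Eventually.of_forall fun t => ?_)
    simp only
    have : cexp (-(zt t * u)) = cexp (-(Real.pi * u)) * cexp (u * t * I) := by
      rw [← Complex.exp_add, zt]; ring_nf
    rw [this]; ring
  · have hprod : Integrable (fun z : ℝ × ℝ => wt z.1 * (z.2 ^ (σ.re - 1) * Real.exp (-(Real.pi * z.2))))
        (volume.prod (volume.restrict (Set.Ioi 0))) :=
      wt_integrable.mul_prod (integrable_gamma_kernel hσ Real.pi_pos)
    refine hprod.mono' ?_ ?_
    · have hm : Measurable (fun z : ℝ × ℝ => (z.2 : ℂ) ^ (σ - 1) * cexp (-(zt z.1 * z.2)) * (wt z.1 : ℂ)) := by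
        have := zt_cont.measurable
        have := wt_cont.measurable
        fun_prop
      exact hm.aestronglyMeasurable
    · have hae : ∀ᵐ z : ℝ × ℝ ∂(volume.prod (volume.restrict (Set.Ioi (0:ℝ)))), z.2 ∈ Set.Ioi (0:ℝ) :=
        Measure.quasiMeasurePreserving_snd.ae (ae_restrict_mem measurableSet_Ioi)
      filter_upwards [hae] with z hz
      simp only [Function.uncurry]
      rw [norm_mul, gamma_norm _ _ hz, zt_re, norm_real, Real.norm_of_nonneg (wt_pos _).le]
      simp [mul_comm]

lemma hasSum_eta {σ : ℂ} (hσ : 1 < σ.re) :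
    HasSum (fun n : ℕ => (-1 : ℂ) ^ n / ((n + 1 : ℂ)) ^ σ) ((1 - 2 ^ (1 - σ)) * riemannZeta σ) := by
  have hs : Summable (fun n : ℕ => 1 / ((n + 1 : ℂ)) ^ σ) := by
    have := (summable_nat_add_iff 1).mpr (Complex.summable_one_div_nat_cpow.mpr hσ)
    simpa using this
  have hz : HasSum (fun n : ℕ => 1 / ((n + 1 : ℂ)) ^ σ) (riemannZeta σ) := by
    rw [zeta_eq_tsum_one_div_nat_add_one_cpow hσ]
    exact hs.hasSum
  have hodd : HasSum (fun k : ℕ => 1 / (((2 * k + 1 : ℕ) + 1 : ℂ)) ^ σ) (2 ^ (-σ) * riemannZeta σ) := by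
    convert! hz.mul_left ((2:ℂ) ^ (-σ)) using 2 with k
    have e : (((2 * k + 1 : ℕ) : ℂ) + 1) = ((2 : ℝ) : ℂ) * ((k + 1 : ℝ) : ℂ) := by
      push_cast; ring
    rw [e, mul_cpow_ofReal_nonneg (by norm_num) (by positivity), cpow_neg]
    push_cast
    rw [one_div, one_div, mul_inv]
  have heven : HasSum (fun k : ℕ => 1 / (((2 * k : ℕ) + 1 : ℂ)) ^ σ)
      (riemannZeta σ - 2 ^ (-σ) * riemannZeta σ) := by
    have hse : Summable (fun k : ℕ => 1 / (((2 * k : ℕ) + 1 : ℂ)) ^ σ) :=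
      hs.comp_injective (i := fun k : ℕ => 2 * k) (fun a b h => by simpa using h)
    have h := HasSum.even_add_odd (f := fun n : ℕ => 1 / ((n + 1 : ℂ)) ^ σ) hse.hasSum hodd
    have := h.unique hz
    have h3 := eq_sub_of_add_eq this
    rw [← h3]
    exact hse.hasSum
  have h2 : (2 : ℂ) ^ (1 - σ) = 2 * 2 ^ (-σ) := by
    rw [sub_eq_add_neg, cpow_add _ _ two_ne_zero, cpow_one]
  have : (1 - 2 ^ (1 - σ)) * riemannZeta σ = (riemannZeta σ - 2 ^ (-σ) * riemannZeta σ)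
      + -(2 ^ (-σ) * riemannZeta σ) := by rw [h2]; ring
  rw [this]
  refine HasSum.even_add_odd ?_ ?_
  · simpa [pow_mul] using heven
  · have := hodd.neg
    simpa [pow_succ, pow_mul, neg_div] using this

lemma F_formula {σ : ℂ} (hσ : 1 < σ.re) :
    Fs (-σ) = ((2 * Real.pi / 5 : ℝ) : ℂ) ^ (1 - σ) *
      ((1 - 2 ^ (1 - σ)) * riemannZeta σ - 1 + 2 ^ (-σ)) := by
  set c : ℝ := 2 * Real.pi / 5 with hc
  have hcpos : 0 < c := by have := Real.pi_pos; positivity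
  have hσ0 : 0 < σ.re := by linarith
  -- the alternating sum from n = 3
  have hsum : HasSum (fun n : ℕ => (-1 : ℂ) ^ n / ((n + 3 : ℂ)) ^ σ)
      ((1 - 2 ^ (1 - σ)) * riemannZeta σ - 1 + 2 ^ (-σ)) := by
    have h := (hasSum_nat_add_iff' 2).mpr (hasSum_eta hσ)
    have e : (1 - (2:ℂ) ^ (1 - σ)) * riemannZeta σ -
        ∑ i ∈ Finset.range 2, (-1 : ℂ) ^ i / ((i + 1 : ℂ)) ^ σ =
        (1 - 2 ^ (1 - σ)) * riemannZeta σ - 1 + 2 ^ (-σ) := by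
      simp only [Finset.sum_range_succ, Finset.sum_range_zero]
      norm_num
      rw [cpow_neg]
      ring
    rw [e] at h
    convert! h using 2 with n
    rw [pow_add]
    push_cast
    ring_nf
  have hmel := hasSum_mellin (ι := ℕ) (a := fun n => (c : ℂ) * (-1) ^ n) (p := fun n => c * (n + 3))
    (F := fun u : ℝ => cexp (-(Real.pi * u)) * ((Real.pi / 5 : ℂ) / Complex.cosh (Real.pi * u / 5)))
    (s := σ) (fun n => Or.inr (by positivity)) hσ0 ?_ ?_
  · rw [← F_fubini hσ0] at hmel
    have h2 := hsum.mul_left (Gamma σ * (c : ℂ) ^ (1 - σ))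
    have h3 : Gamma σ * Fs (-σ) = Gamma σ * (c : ℂ) ^ (1 - σ) *
        ((1 - 2 ^ (1 - σ)) * riemannZeta σ - 1 + 2 ^ (-σ)) := by
      refine hmel.unique ?_
      convert! h2 using 2 with n
      have hcc : (c : ℂ) ≠ 0 := by exact_mod_cast hcpos.ne'
      rw [ofReal_mul, mul_cpow_ofReal_nonneg hcpos.le (by positivity), cpow_sub _ _ hcc, cpow_one]
      push_cast
      ring
    rw [mul_assoc] at h3
    exact mul_left_cancel₀ (Gamma_ne_zero_of_re_pos hσ0) h3
  · intro u hu
    have hu' : 0 < u := hu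
    have hq : ‖-cexp (-(c * u))‖ < 1 := by
      rw [norm_neg, ← ofReal_mul, ← ofReal_neg, ← ofReal_exp, norm_real,
        Real.norm_of_nonneg (Real.exp_pos _).le, Real.exp_lt_one_iff]
      have : 0 < c * u := by positivity
      linarith
    have hg := (hasSum_geometric_of_norm_lt_one hq).mul_left ((c : ℂ) * cexp (-(c * 3 * u)))
    convert! hg using 1
    · ext n
      push_cast
      rw [neg_pow (cexp _), ← Complex.exp_nat_mul]
      rw [show (c : ℂ) * (-1) ^ n * cexp (-(c * (n + 3)) * u) =
        c * (-1) ^ n * (cexp (-(c * 3 * u)) * cexp (n * -(c * u))) by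
          rw [← Complex.exp_add]; ring_nf]
      ring
    · simp only [Complex.cosh]
      set E := cexp (-(Real.pi * u / 5)) with hE
      have hE0 : E ≠ 0 := Complex.exp_ne_zero _
      have e1 : cexp (Real.pi * u / 5) = E⁻¹ := by rw [hE, ← Complex.exp_neg, neg_neg]
      have e2 : cexp (-(Real.pi * u)) = E ^ 5 := by
        rw [hE, ← Complex.exp_nat_mul]; push_cast; ring_nf
      have e3 : cexp (-(c * u)) = E ^ 2 := by
        rw [hE, ← Complex.exp_nat_mul, hc]; push_cast; ring_nf
      have e4 : cexp (-(c * 3 * u)) = E ^ 6 := by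
        rw [hE, ← Complex.exp_nat_mul, hc]; push_cast; ring_nf
      rw [e3] at hq
      have hne : 1 + E ^ 2 ≠ 0 := by
        intro h
        have : E ^ 2 = -1 := by linear_combination h
        rw [this] at hq; simp at hq
      rw [e1, e2, e3, e4, sub_neg_eq_add, hc]
      have hne' : E⁻¹ + E ≠ 0 := by
        intro h
        apply hne
        field_simp at h
        simpa using h
      push_cast
      field_simp
  · have : Summable (fun n : ℕ => 1 / ((n : ℝ) + 3) ^ σ.re) := by
      have := (summable_nat_add_iff 3).mpr (Real.summable_one_div_nat_rpow.mpr hσ)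
      simpa using this
    refine (this.mul_left (c / c ^ σ.re)).congr fun n => ?_
    rw [Real.mul_rpow hcpos.le (by positivity)]
    simp [abs_of_pos hcpos]
    field_simp

lemma F_formula' {s : ℂ} (hs : s ≠ -1) :
    Fs s = ((2 * Real.pi / 5 : ℝ) : ℂ) ^ (1 + s) *
      ((1 - 2 ^ (1 + s)) * riemannZeta (-s) - 1 + 2 ^ s) := by
  have hcc : ((2 * Real.pi / 5 : ℝ) : ℂ) ≠ 0 := by
    have := Real.pi_pos
    exact_mod_cast (by positivity : (2 * Real.pi / 5 : ℝ) ≠ 0)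
  have hpc : IsPreconnected ({-1}ᶜ : Set ℂ) :=
    (isConnected_compl_singleton_of_one_lt_rank (by simp) _).isPreconnected
  have hf : AnalyticOnNhd ℂ Fs ({-1}ᶜ : Set ℂ) :=
    DifferentiableOn.analyticOnNhd
      (fun z _ => (F_hasDeriv z).2.differentiableAt.differentiableWithinAt) isOpen_compl_singleton
  have hg : AnalyticOnNhd ℂ (fun s : ℂ => ((2 * Real.pi / 5 : ℝ) : ℂ) ^ (1 + s) *
      ((1 - 2 ^ (1 + s)) * riemannZeta (-s) - 1 + 2 ^ s)) ({-1}ᶜ : Set ℂ) := by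
    refine DifferentiableOn.analyticOnNhd (fun z hz => ?_) isOpen_compl_singleton
    refine DifferentiableAt.differentiableWithinAt ?_
    have hz1 : -z ≠ 1 := fun h => hz (by rw [← h]; simp)
    have hζ : DifferentiableAt ℂ (fun s : ℂ => riemannZeta (-s)) z :=
      (differentiableAt_riemannZeta hz1).comp z differentiableAt_id.neg
    have h1 : DifferentiableAt ℂ (fun s : ℂ => ((2 * Real.pi / 5 : ℝ) : ℂ) ^ (1 + s)) z :=
      (differentiableAt_id.const_add 1).const_cpow (Or.inl hcc)
    have h2 : DifferentiableAt ℂ (fun s : ℂ => (2 : ℂ) ^ (1 + s)) z :=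
      (differentiableAt_id.const_add 1).const_cpow (Or.inl two_ne_zero)
    have h3 : DifferentiableAt ℂ (fun s : ℂ => (2 : ℂ) ^ s) z :=
      differentiableAt_id.const_cpow (Or.inl two_ne_zero)
    exact h1.mul ((((differentiableAt_const _).sub h2).mul hζ |>.sub_const 1).add h3)
  refine hf.eqOn_of_preconnected_of_eventuallyEq hg hpc (z₀ := -2) (by simp) ?_ hs
  have : {z : ℂ | z.re < -1} ∈ nhds (-2 : ℂ) :=
    (isOpen_lt continuous_re continuous_const).mem_nhds (by simp)
  filter_upwards [this] with z hz
  have hz' : z.re < -1 := hz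
  have := F_formula (σ := -z) (by simp; linarith)
  simpa using this

lemma zeta_neg_one : riemannZeta (-1) = -1 / 12 := by
  have := riemannZeta_neg_nat_eq_bernoulli' 1
  norm_num [bernoulli'_two] at this
  rw [this]; norm_num

lemma Fs_one : Fs 1 = (Real.pi : ℂ) ^ 2 / 5 := by
  rw [F_formula' (by norm_num), zeta_neg_one]
  have : (1 + 1 : ℂ) = (2 : ℕ) := by norm_num
  rw [this, cpow_natCast, cpow_natCast, cpow_one]
  push_cast
  ring

lemma J_eq : ∫ t : ℝ, zt t ^ (1:ℂ) * Complex.log (zt t) * (wt t : ℂ) =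
    (Real.pi : ℂ) ^ 2 / 25 * (5 * (Real.log (2 * Real.pi / 5) : ℂ) + 4 / 3 * Real.log 2 + 8 * Real.log 2
      + 12 * deriv riemannZeta (-1)) := by
  have hcpos : 0 < 2 * Real.pi / 5 := by have := Real.pi_pos; positivity
  have hcc : ((2 * Real.pi / 5 : ℝ) : ℂ) ≠ 0 := by exact_mod_cast hcpos.ne'
  have hζ : HasDerivAt (fun s : ℂ => riemannZeta (-s)) (deriv riemannZeta (-1) * (-1)) 1 :=
    HasDerivAt.comp (1:ℂ) (h₂ := riemannZeta)
      (differentiableAt_riemannZeta (by norm_num : (-1:ℂ) ≠ 1)).hasDerivAt (hasDerivAt_neg (1:ℂ))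
  have h1 : HasDerivAt (fun s : ℂ => ((2 * Real.pi / 5 : ℝ) : ℂ) ^ (1 + s)) _ 1 :=
    ((hasDerivAt_id (1:ℂ)).const_add 1).const_cpow (Or.inl hcc)
  have h2 : HasDerivAt (fun s : ℂ => (2 : ℂ) ^ (1 + s)) _ 1 :=
    ((hasDerivAt_id (1:ℂ)).const_add 1).const_cpow (Or.inl two_ne_zero)
  have h3 : HasDerivAt (fun s : ℂ => (2 : ℂ) ^ s) _ 1 :=
    (hasDerivAt_id (1:ℂ)).const_cpow (Or.inl two_ne_zero)
  have hg := h1.fun_mul ((((hasDerivAt_const (1:ℂ) (1:ℂ)).fun_sub h2).fun_mul hζ |>.sub_const 1).fun_add h3)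
  have hev : Fs =ᶠ[nhds 1] (fun s : ℂ => ((2 * Real.pi / 5 : ℝ) : ℂ) ^ (1 + s) *
      ((1 - 2 ^ (1 + s)) * riemannZeta (-s) - 1 + 2 ^ s)) := by
    filter_upwards [isOpen_compl_singleton.mem_nhds (show (1:ℂ) ∈ ({-1}ᶜ : Set ℂ) by
      simp only [Set.mem_compl_iff, Set.mem_singleton_iff]; norm_num)] with s hs
    exact F_formula' hs
  have := (F_hasDeriv 1).2.unique (hg.congr_of_eventuallyEq hev)
  rw [this, zeta_neg_one]
  have e : (1 + 1 : ℂ) = (2 : ℕ) := by norm_num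
  simp only [id, e, cpow_natCast, cpow_one]
  rw [← ofReal_log hcpos.le, show (2:ℂ) = ((2:ℝ):ℂ) by norm_num, ← ofReal_log (by norm_num)]
  push_cast
  ring

lemma zeta_deriv_real : ((deriv riemannZeta (-1)).re : ℂ) = deriv riemannZeta (-1) := by
  rw [← Complex.conj_eq_iff_re]
  have h : ((starRingEnd ℂ) ∘ riemannZeta ∘ (starRingEnd ℂ)) = riemannZeta := by
    ext s
    simp [riemannZeta_conj]
  have h2 := congrFun (deriv_conj_conj (𝕜 := ℂ) (f := riemannZeta)) (-1)
  rw [h] at h2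
  simpa using h2.symm

lemma log_split (t : ℝ) : Complex.log (t + Real.pi * I) = Real.pi / 2 * I + Complex.log (zt t) := by
  have e : (t + Real.pi * I : ℂ) = I * zt t := by
    rw [zt]; ring_nf; rw [I_sq]; ring
  have harg : |arg (zt t)| < Real.pi / 2 := by
    rw [abs_arg_lt_pi_div_two_iff]; left; rw [zt_re]; exact Real.pi_pos
  rw [abs_lt] at harg
  rw [e, Complex.log_mul I_ne_zero (zt_ne t), log_I]
  rw [arg_I]
  constructor <;> linarith [Real.pi_pos]

lemma integral_change :
    (∫ x : ℝ in Set.Ioi (0 : ℝ),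
        ((x ^ ((3 : ℝ) / 2) : ℝ) : ℂ) * Complex.log (-(x : ℂ)) *
          Complex.log (Complex.log (-(x : ℂ))) / (1 + (x : ℂ) ^ 5)) =
    ∫ t : ℝ, (-(Real.pi / 2 : ℂ) * (zt t ^ (1:ℂ) * (wt t : ℂ)) +
      I * (zt t ^ (1:ℂ) * Complex.log (zt t) * (wt t : ℂ))) := by
  have himg : Real.exp '' Set.univ = Set.Ioi 0 := by
    rw [Set.image_univ, Real.range_exp]
  rw [← himg, integral_image_eq_integral_abs_deriv_smul (f' := Real.exp) MeasurableSet.univ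
    (fun t _ => (Real.hasDerivAt_exp t).hasDerivWithinAt) Real.exp_injective.injOn,
    Measure.restrict_univ]
  refine integral_congr_ae (Filter.Eventually.of_forall fun t => ?_)
  simp only
  have hlog : Complex.log (-((Real.exp t : ℝ) : ℂ)) = t + Real.pi * I := by
    rw [← ofReal_neg, Complex.log, arg_ofReal_of_neg (by have := Real.exp_pos t; linarith)]
    simp
  rw [hlog, log_split, abs_of_pos (Real.exp_pos t), real_smul, cpow_one]
  have hr : Real.exp t ^ ((3:ℝ) / 2) = Real.exp (3 * t / 2) := by
    rw [← Real.exp_mul]; ring_nf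
  have hw : Real.exp t * Real.exp (3 * t / 2) / (1 + Real.exp t ^ 5) = wt t := by
    rw [wt, Real.cosh_eq, ← Real.exp_add, ← Real.exp_nat_mul, div_eq_div_iff (by positivity) (by positivity)]
    have h1 : Real.exp (5 * t / 2) * Real.exp (5 * t / 2) = Real.exp ((5:ℕ) * t) := by
      rw [← Real.exp_add]; push_cast; ring_nf
    have h2 : Real.exp (5 * t / 2) * Real.exp (-(5 * t / 2)) = 1 := by
      rw [← Real.exp_add]; simp
    have h3 : t + 3 * t / 2 = 5 * t / 2 := by ring
    rw [h3, ← h1]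
    linear_combination h2
  rw [hr, ← hw]
  push_cast
  have e : (t + Real.pi * I : ℂ) = I * zt t := by
    rw [zt]; ring_nf; rw [I_sq]; ring
  rw [e]
  ring_nf
  rw [I_sq]
  ring


lemma final_log : Complex.log (3125 * glaisher ^ 12 /
            (16384 * (2 : ℂ) ^ ((1 : ℂ) / 3) * Complex.exp 1 * (Real.pi : ℂ) ^ 5)) =
    -(5 * (Real.log (2 * Real.pi / 5) : ℂ) + 4 / 3 * Real.log 2 + 8 * Real.log 2
      + 12 * deriv riemannZeta (-1)) := by
  set d := (deriv riemannZeta (-1)).re with hd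
  have hdd : deriv riemannZeta (-1) = (d : ℂ) := zeta_deriv_real.symm
  have hpi := Real.pi_pos
  have key : 3125 * glaisher ^ 12 /
            (16384 * (2 : ℂ) ^ ((1 : ℂ) / 3) * Complex.exp 1 * (Real.pi : ℂ) ^ 5) =
    ((3125 * Real.exp (1 / 12 - d) ^ 12 / (16384 * (2:ℝ) ^ ((1:ℝ) / 3) * Real.exp 1 * Real.pi ^ 5) : ℝ) : ℂ) := by
    rw [glaisher, hdd]
    push_cast
    rw [ofReal_cpow (by norm_num)]
    push_cast
    rfl
  rw [key, ← ofReal_log (by positivity), hdd]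
  have : Real.log (3125 * Real.exp (1 / 12 - d) ^ 12 / (16384 * (2:ℝ) ^ ((1:ℝ) / 3) * Real.exp 1 * Real.pi ^ 5))
      = -(5 * Real.log (2 * Real.pi / 5) + 4 / 3 * Real.log 2 + 8 * Real.log 2 + 12 * d) := by
    rw [Real.log_div (by positivity) (by positivity), Real.log_mul (by positivity) (by positivity),
      Real.log_mul (by positivity) (by positivity), Real.log_mul (by positivity) (by positivity),
      Real.log_mul (by positivity) (by positivity), Real.log_pow, Real.log_pow, Real.log_exp, Real.log_exp,
      Real.log_rpow (by norm_num), Real.log_div (by positivity) (by norm_num), Real.log_mul (by norm_num) hpi.ne',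
      show (3125:ℝ) = 5 ^ 5 by norm_num, show (16384:ℝ) = 2 ^ 14 by norm_num, Real.log_pow, Real.log_pow]
    push_cast
    ring
  rw [this]
  push_cast
  ring

theorem statement16 :
    (∫ x : ℝ in Set.Ioi (0 : ℝ),
        ((x ^ ((3 : ℝ) / 2) : ℝ) : ℂ) * Complex.log (-(x : ℂ)) *
          Complex.log (Complex.log (-(x : ℂ))) / (1 + (x : ℂ) ^ 5)) =
      -((Real.pi : ℂ) ^ 2 / 25) *
        (5 * (Real.pi : ℂ) / 2 +
          I * Complex.log (3125 * glaisher ^ 12 /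
            (16384 * (2 : ℂ) ^ ((1 : ℂ) / 3) * Complex.exp 1 * (Real.pi : ℂ) ^ 5))) := by
  rw [integral_change, integral_add ((F_integrable 1).const_mul _) ((F_hasDeriv 1).1.const_mul _),
    integral_const_mul, integral_const_mul, J_eq, final_log]
  have h := Fs_one
  rw [Fs] at h
  rw [h]
  ring
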